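/- Let p, q, r : ℝ⁴ → ℝ be smooth, and let μ₁, μ₂ be the vector fields on ℝ⁵ defined by μ₁(x,ζ) = (1, ζ, (r+ζq)/2, −(p+ζr)/2, Q₁(x,ζ)) with Q₁(x,ζ) = −½∂₂p − (½∂₃p + ∂₂r)ζ − (½∂₂q + ∂₃r)ζ² − ½∂₃q·ζ³, and μ₂(x,ζ) = (0,0,1,ζ,0). Then the following are equivalent: (i) for every x ∈ ℝ⁴ and every ζ ∈ ℝ, the Lie bracket [μ₁,μ₂](x,ζ) lies in the linear span of μ₁(x,ζ) and μ₂(x,ζ) (i.e. the twistor distribution is involutive); (ii) p, q, r satisfy the coordinate self-duality system at every point: ∂₂²p = 0, ∂₃²q = 0, ∂₂²r + ∂₂∂₃p = 0, ∂₃²r + ∂₂∂₃q = 0, ∂₃²p + ∂₂²q + 4∂₂∂₃r = 0. (This expresses that the neutral metric G(p,q,r) on ℝ⁴ is self-dual precisely when this PDE system holds.) -/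

import Mathlib

noncomputable section

/-- Partial derivative `∂ᵢ f` of a function on `ℝ⁴`. -/
def pd (f : (Fin 4 → ℝ) → ℝ) (i : Fin 4) (x : Fin 4 → ℝ) : ℝ :=
  fderiv ℝ f x (Pi.single i 1)

/-- `Q₁(x,ζ) = −½∂₂p − (½∂₃p + ∂₂r)ζ − (½∂₂q + ∂₃r)ζ² − ½∂₃q·ζ³`. -/
def Q1 (p q r : (Fin 4 → ℝ) → ℝ) (x : Fin 4 → ℝ) (ζ : ℝ) : ℝ :=
  -(1 / 2) * pd p 2 x - ((1 / 2) * pd p 3 x + pd r 2 x) * ζ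
    - ((1 / 2) * pd q 2 x + pd r 3 x) * ζ ^ 2 - (1 / 2) * pd q 3 x * ζ ^ 3

/-- The `ℝ⁴`-part of a point of `ℝ⁵ = ℝ⁴ × ℝ_ζ`. -/
def xpart (y : Fin 5 → ℝ) : Fin 4 → ℝ := ![y 0, y 1, y 2, y 3]

/-- `μ₁(x,ζ) = (1, ζ, (r+ζq)/2, −(p+ζr)/2, Q₁(x,ζ))`. -/
def mu1 (p q r : (Fin 4 → ℝ) → ℝ) (y : Fin 5 → ℝ) : Fin 5 → ℝ :=
  ![1, y 4, (r (xpart y) + y 4 * q (xpart y)) / 2,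
    -(p (xpart y) + y 4 * r (xpart y)) / 2, Q1 p q r (xpart y) (y 4)]

/-- `μ₂(x,ζ) = (0, 0, 1, ζ, 0)`. -/
def mu2 (y : Fin 5 → ℝ) : Fin 5 → ℝ := ![0, 0, 1, y 4, 0]

/-- Lie bracket of vector fields on `ℝ⁵`: `[V,W](y) = DW(y)·V(y) − DV(y)·W(y)`. -/
def lieBracket5 (V W : (Fin 5 → ℝ) → (Fin 5 → ℝ)) (y : Fin 5 → ℝ) : Fin 5 → ℝ :=
  fderiv ℝ W y (V y) - fderiv ℝ V y (W y)

open scoped ContDiff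

lemma ContDiff.pd {f : (Fin 4 → ℝ) → ℝ} (hf : ContDiff ℝ ∞ f) (i : Fin 4) :
    ContDiff ℝ ∞ (pd f i) :=
  (hf.fderiv_right (m := ∞) (by simp)).clm_apply contDiff_const

lemma pd_comm {f : (Fin 4 → ℝ) → ℝ} (hf : ContDiff ℝ ∞ f) (i j : Fin 4) (x : Fin 4 → ℝ) :
    pd (pd f i) j x = pd (pd f j) i x := by
  have hd : DifferentiableAt ℝ (fderiv ℝ f) x :=
    ((hf.fderiv_right (m := ∞) (by simp)).differentiable (by simp)).differentiableAt
  have pd_pd (k l : Fin 4) : pd (pd f k) l x =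
      fderiv ℝ (fderiv ℝ f) x (Pi.single l 1) (Pi.single k 1) := by
    change fderiv ℝ (fun z => fderiv ℝ f z (Pi.single k 1)) x _ = _
    rw [fderiv_clm_apply hd (by fun_prop)]
    simp
  rw [pd_pd, pd_pd]
  exact (hf.contDiffAt.isSymmSndFDerivAt (by simpa using WithTop.coe_le_coe.2 (le_top (a := (2 : ℕ∞))))).eq _ _

lemma contDiff_xpart : ContDiff ℝ ∞ xpart := by
  unfold xpart
  rw [contDiff_pi]
  intro i
  fin_cases i <;> simp <;> fun_prop

lemma contDiff_Q1 {p q r : (Fin 4 → ℝ) → ℝ} (hp : ContDiff ℝ ∞ p) (hq : ContDiff ℝ ∞ q)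
    (hr : ContDiff ℝ ∞ r) : ContDiff ℝ ∞ (fun y : Fin 5 → ℝ => Q1 p q r (xpart y) (y 4)) := by
  have h {f : (Fin 4 → ℝ) → ℝ} (hf : ContDiff ℝ ∞ f) (i : Fin 4) :
      ContDiff ℝ ∞ (fun y => pd f i (xpart y)) := (hf.pd i).comp contDiff_xpart
  have hp2 := h hp 2
  have hp3 := h hp 3
  have hq2 := h hq 2
  have hq3 := h hq 3
  have hr2 := h hr 2
  have hr3 := h hr 3
  unfold Q1
  fun_prop

lemma contDiff_mu1 {p q r : (Fin 4 → ℝ) → ℝ} (hp : ContDiff ℝ ∞ p) (hq : ContDiff ℝ ∞ q)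
    (hr : ContDiff ℝ ∞ r) : ContDiff ℝ ∞ (mu1 p q r) := by
  have hpx : ContDiff ℝ ∞ (fun y => p (xpart y)) := hp.comp contDiff_xpart
  have hqx : ContDiff ℝ ∞ (fun y => q (xpart y)) := hq.comp contDiff_xpart
  have hrx : ContDiff ℝ ∞ (fun y => r (xpart y)) := hr.comp contDiff_xpart
  have hζ : ContDiff ℝ ∞ (fun y : Fin 5 → ℝ => y 4) := contDiff_apply ℝ ℝ 4
  rw [contDiff_pi]
  intro i
  fin_cases i
  · exact contDiff_const
  · exact hζ
  · exact (hrx.add (hζ.mul hqx)).div_const 2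
  · exact (hpx.add (hζ.mul hrx)).neg.div_const 2
  · exact contDiff_Q1 hp hq hr

lemma contDiff_mu2 : ContDiff ℝ ∞ mu2 := by
  unfold mu2
  rw [contDiff_pi]
  intro i
  fin_cases i <;> simp <;> fun_prop

lemma hasDerivAt_apply_line {V : (Fin 5 → ℝ) → (Fin 5 → ℝ)} (hV : ContDiff ℝ ∞ V)
    (y w : Fin 5 → ℝ) (i : Fin 5) :
    HasDerivAt (fun t : ℝ => V (y + t • w) i) (fderiv ℝ V y w i) 0 :=
  hasDerivAt_pi.1
    ((hV.differentiable (by simp)).differentiableAt.hasFDerivAt.hasLineDerivAt w) i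

lemma fderiv_mu2_apply (y w : Fin 5 → ℝ) : fderiv ℝ mu2 y w = ![0, 0, 0, w 4, 0] := by
  ext i
  refine (hasDerivAt_apply_line contDiff_mu2 y w i).unique ?_
  fin_cases i <;> simp [mu2, hasDerivAt_const]
  simpa using ((hasDerivAt_id (0 : ℝ)).mul_const (w 4)).const_add (y 4)

lemma xpart_add_smul_mu2 (y : Fin 5 → ℝ) (t : ℝ) :
    xpart (y + t • mu2 y) =
      xpart y + t • (Pi.single 2 1 + y 4 • Pi.single 3 1 : Fin 4 → ℝ) := by
  ext i
  fin_cases i <;> simp [xpart, mu2]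

lemma hasDerivAt_comp_xpart_line {f : (Fin 4 → ℝ) → ℝ} (hf : ContDiff ℝ ∞ f)
    (y : Fin 5 → ℝ) :
    HasDerivAt (fun t : ℝ => f (xpart (y + t • mu2 y)))
      (pd f 2 (xpart y) + y 4 * pd f 3 (xpart y)) 0 := by
  simp_rw [xpart_add_smul_mu2]
  have h := (hf.differentiable (by simp)).differentiableAt.hasFDerivAt (x := xpart y)
    |>.hasLineDerivAt (Pi.single 2 1 + y 4 • Pi.single 3 1)
  simpa [HasLineDerivAt, pd] using h

/-- The derivative of `Q₁` along `μ₂` is a quartic polynomial in `ζ`. -/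
lemma hasDerivAt_Q1_line {p q r : (Fin 4 → ℝ) → ℝ} (hp : ContDiff ℝ ∞ p)
    (hq : ContDiff ℝ ∞ q) (hr : ContDiff ℝ ∞ r) (y : Fin 5 → ℝ) :
    HasDerivAt (fun t : ℝ => Q1 p q r (xpart (y + t • mu2 y)) (y 4))
      (-(1 / 2) * (pd (pd p 2) 2 (xpart y)
        + 2 * (pd (pd r 2) 2 (xpart y) + pd (pd p 3) 2 (xpart y)) * y 4
        + (pd (pd p 3) 3 (xpart y) + pd (pd q 2) 2 (xpart y)
          + 4 * pd (pd r 3) 2 (xpart y)) * y 4 ^ 2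
        + 2 * (pd (pd r 3) 3 (xpart y) + pd (pd q 3) 2 (xpart y)) * y 4 ^ 3
        + pd (pd q 3) 3 (xpart y) * y 4 ^ 4)) 0 := by
  have d {f : (Fin 4 → ℝ) → ℝ} (hf : ContDiff ℝ ∞ f) (i : Fin 4) :=
    hasDerivAt_comp_xpart_line (hf.pd i) y
  unfold Q1
  refine (((((d hp 2).const_mul (-(1 / 2))).sub
    ((((d hp 3).const_mul (1 / 2)).add (d hr 2)).mul_const (y 4))).sub
    ((((d hq 2).const_mul (1 / 2)).add (d hr 3)).mul_const (y 4 ^ 2))).sub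
    (((d hq 3).const_mul (1 / 2)).mul_const (y 4 ^ 3))).congr_deriv ?_
  rw [pd_comm hp 2 3, pd_comm hq 2 3, pd_comm hr 2 3]
  ring

lemma fderiv_mu1_apply_mu2 {p q r : (Fin 4 → ℝ) → ℝ} (hp : ContDiff ℝ ∞ p)
    (hq : ContDiff ℝ ∞ q) (hr : ContDiff ℝ ∞ r) (y : Fin 5 → ℝ) :
    fderiv ℝ (mu1 p q r) y (mu2 y) =
      ![0, 0,
        (pd r 2 (xpart y) + y 4 * pd r 3 (xpart y)
          + y 4 * (pd q 2 (xpart y) + y 4 * pd q 3 (xpart y))) / 2,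
        -(pd p 2 (xpart y) + y 4 * pd p 3 (xpart y)
          + y 4 * (pd r 2 (xpart y) + y 4 * pd r 3 (xpart y))) / 2,
        -(1 / 2) * (pd (pd p 2) 2 (xpart y)
          + 2 * (pd (pd r 2) 2 (xpart y) + pd (pd p 3) 2 (xpart y)) * y 4
          + (pd (pd p 3) 3 (xpart y) + pd (pd q 2) 2 (xpart y)
            + 4 * pd (pd r 3) 2 (xpart y)) * y 4 ^ 2
          + 2 * (pd (pd r 3) 3 (xpart y) + pd (pd q 3) 2 (xpart y)) * y 4 ^ 3
          + pd (pd q 3) 3 (xpart y) * y 4 ^ 4)] := by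
  have hζ (t : ℝ) : (y + t • mu2 y) 4 = y 4 := by simp [mu2]
  have dp := hasDerivAt_comp_xpart_line hp y
  have dq := hasDerivAt_comp_xpart_line hq y
  have dr := hasDerivAt_comp_xpart_line hr y
  ext i
  refine (hasDerivAt_apply_line (contDiff_mu1 hp hq hr) y (mu2 y) i).unique ?_
  unfold mu1
  simp_rw [hζ]
  fin_cases i
  · exact hasDerivAt_const _ _
  · exact hasDerivAt_const _ _
  · exact (dr.add (dq.const_mul (y 4))).div_const 2
  · exact (dp.add (dr.const_mul (y 4))).neg.div_const 2
  · exact hasDerivAt_Q1_line hp hq hr y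

/-- The bracket is congruent to a multiple of `∂_ζ` modulo `μ₂`. -/
lemma lieBracket5_mu1_mu2 {p q r : (Fin 4 → ℝ) → ℝ} (hp : ContDiff ℝ ∞ p)
    (hq : ContDiff ℝ ∞ q) (hr : ContDiff ℝ ∞ r) (y : Fin 5 → ℝ) :
    lieBracket5 (mu1 p q r) mu2 y =
      (-(pd r 2 (xpart y) + y 4 * pd r 3 (xpart y)
          + y 4 * (pd q 2 (xpart y) + y 4 * pd q 3 (xpart y))) / 2) • mu2 y +
      ![0, 0, 0, 0, (1 / 2) * (pd (pd p 2) 2 (xpart y)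
          + 2 * (pd (pd r 2) 2 (xpart y) + pd (pd p 3) 2 (xpart y)) * y 4
          + (pd (pd p 3) 3 (xpart y) + pd (pd q 2) 2 (xpart y)
            + 4 * pd (pd r 3) 2 (xpart y)) * y 4 ^ 2
          + 2 * (pd (pd r 3) 3 (xpart y) + pd (pd q 3) 2 (xpart y)) * y 4 ^ 3
          + pd (pd q 3) 3 (xpart y) * y 4 ^ 4)] := by
  rw [lieBracket5, fderiv_mu2_apply, fderiv_mu1_apply_mu2 hp hq hr]
  ext i
  fin_cases i <;> simp [mu1, mu2, Q1] <;> ring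

lemma quartic_coeffs_eq_zero {a b c d e : ℝ}
    (h : ∀ z : ℝ, a + b * z + c * z ^ 2 + d * z ^ 3 + e * z ^ 4 = 0) :
    a = 0 ∧ b = 0 ∧ c = 0 ∧ d = 0 ∧ e = 0 := by
  have h0 := h 0
  have h1 := h 1
  have h2 := h (-1)
  have h3 := h 2
  have h4 := h (-2)
  norm_num at h0 h1 h2 h3 h4
  refine ⟨?_, ?_, ?_, ?_, ?_⟩ <;> linarith

/-- The twistor distribution spanned by `μ₁, μ₂` is involutive iff `p, q, r` satisfy the
coordinate self-duality system (i.e. the neutral metric `G(p,q,r)` is self-dual). -/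
theorem stmt12 (p q r : (Fin 4 → ℝ) → ℝ)
    (hp : ContDiff ℝ (⊤ : ℕ∞) p) (hq : ContDiff ℝ (⊤ : ℕ∞) q) (hr : ContDiff ℝ (⊤ : ℕ∞) r) :
    (∀ y : Fin 5 → ℝ, ∃ s t : ℝ,
        lieBracket5 (mu1 p q r) mu2 y = s • mu1 p q r y + t • mu2 y) ↔
      (∀ x : Fin 4 → ℝ,
        pd (pd p 2) 2 x = 0 ∧
        pd (pd q 3) 3 x = 0 ∧
        pd (pd r 2) 2 x + pd (pd p 3) 2 x = 0 ∧
        pd (pd r 3) 3 x + pd (pd q 3) 2 x = 0 ∧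
        pd (pd p 3) 3 x + pd (pd q 2) 2 x + 4 * pd (pd r 3) 2 x = 0) := by
  constructor
  · intro h x
    have hquartic (z : ℝ) : pd (pd p 2) 2 x
        + 2 * (pd (pd r 2) 2 x + pd (pd p 3) 2 x) * z
        + (pd (pd p 3) 3 x + pd (pd q 2) 2 x + 4 * pd (pd r 3) 2 x) * z ^ 2
        + 2 * (pd (pd r 3) 3 x + pd (pd q 3) 2 x) * z ^ 3
        + pd (pd q 3) 3 x * z ^ 4 = 0 := by
      have hx : xpart ![x 0, x 1, x 2, x 3, z] = x := by
        ext i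
        fin_cases i <;> simp [xpart]
      obtain ⟨s, t, hst⟩ := h ![x 0, x 1, x 2, x 3, z]
      rw [lieBracket5_mu1_mu2 hp hq hr, hx] at hst
      have hs : s = 0 := by simpa [mu1, mu2] using (congrFun hst 0).symm
      subst hs
      have h4 := congrFun hst 4
      simp only [mu2, Pi.add_apply, Pi.smul_apply, zero_smul] at h4
      simp at h4
      linarith
    obtain ⟨h0, h1, h2, h3, h4⟩ := quartic_coeffs_eq_zero hquartic
    exact ⟨h0, h4, by linarith, by linarith, h2⟩
  · intro h y
    obtain ⟨h0, h4, h1, h3, h2⟩ := h (xpart y)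
    refine ⟨0, -(pd r 2 (xpart y) + y 4 * pd r 3 (xpart y)
      + y 4 * (pd q 2 (xpart y) + y 4 * pd q 3 (xpart y))) / 2, ?_⟩
    rw [lieBracket5_mu1_mu2 hp hq hr, h0, h1, h2, h3, h4]
    ext i
    fin_cases i <;> simp
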